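/- (Lemma 1, MDP version.) Let μ be a distribution on S×A with μ(s,a) > 0 for all (s,a) that satisfies the MDP contraction mapping condition E_{(s,a)∼μ}[F^π(s,a)] ⪰ 0, and let ν be a stationary distribution of the induced chain P^π with ν(s,a) > 0 for all (s,a). Let Q^π be the unique solution of the Bellman equation Q^π(s,a) = r(s,a) + γ·Σ_{s'} p(s'|s,a)·Σ_{a'} π(a'|s')·Q^π(s',a'), and let w⋆ ∈ ℝᵏ satisfy the projected fixed-point equation Φw⋆ = Π_μ(r + γP^πΦw⋆), where Φ is the |S×A|×k matrix whose row at (s,a) is φ(s,a)ᵀ. Then ‖Φw⋆ − Q^π‖_μ ≤ ((1 + γ√δ(ν,μ))/(1 − γ)) · min_{w ∈ ℝᵏ} ‖Φw − Q^π‖_μ, where δ(ν,μ) = max over pairs (s,a), (s̃,ã) of (ν(s,a)/μ(s,a))·(μ(s̃,ã)/ν(s̃,ã)). -/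

import Mathlib

open Matrix

noncomputable section

/-- The μ-weighted norm `‖x‖_μ = (∑ x, μ x * x x ^ 2)^{1/2}` over a finite index type. -/
def wnorm {X : Type*} [Fintype X] (μ : X → ℝ) (x : X → ℝ) : ℝ :=
  Real.sqrt (∑ s, μ s * (x s) ^ 2)

section Weighted

variable {X : Type*} [Fintype X]

theorem wnorm_sq {μ : X → ℝ} (hμ : ∀ x, 0 ≤ μ x) (f : X → ℝ) :
    wnorm μ f ^ 2 = ∑ x, μ x * f x ^ 2 :=
  Real.sq_sqrt (Finset.sum_nonneg fun x _ => mul_nonneg (hμ x) (sq_nonneg _))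

theorem wnorm_nonneg (μ f : X → ℝ) : 0 ≤ wnorm μ f := Real.sqrt_nonneg _

theorem wnorm_add_sq_of_orthogonal {μ : X → ℝ} (hμ : ∀ x, 0 ≤ μ x) {f g : X → ℝ}
    (h : ∑ x, μ x * (f x * g x) = 0) :
    wnorm μ (f + g) ^ 2 = wnorm μ f ^ 2 + wnorm μ g ^ 2 := by
  have key : ∑ x, μ x * (f + g) x ^ 2
      = ∑ x, μ x * f x ^ 2 + ∑ x, μ x * g x ^ 2 + 2 * ∑ x, μ x * (f x * g x) := by
    rw [Finset.mul_sum, ← Finset.sum_add_distrib, ← Finset.sum_add_distrib]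
    refine Finset.sum_congr rfl fun x _ => ?_
    simp only [Pi.add_apply]
    ring
  rw [wnorm_sq hμ, wnorm_sq hμ, wnorm_sq hμ, key, h]
  ring

/-- Cauchy–Schwarz for the weighted inner product. -/
theorem weighted_inner_le {μ : X → ℝ} (hμ : ∀ x, 0 ≤ μ x) (f g : X → ℝ) :
    ∑ x, μ x * (f x * g x) ≤ wnorm μ f * wnorm μ g := by
  have h := Finset.sum_mul_sq_le_sq_mul_sq Finset.univ
    (fun x => √(μ x) * f x) (fun x => √(μ x) * g x)
  have e1 : ∑ x, √(μ x) * f x * (√(μ x) * g x) = ∑ x, μ x * (f x * g x) :=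
    Finset.sum_congr rfl fun x _ => by
      rw [mul_mul_mul_comm, Real.mul_self_sqrt (hμ x)]
  have e2 (f : X → ℝ) : ∑ x, (√(μ x) * f x) ^ 2 = wnorm μ f ^ 2 := by
    rw [wnorm_sq hμ]
    exact Finset.sum_congr rfl fun x _ => by rw [mul_pow, Real.sq_sqrt (hμ x)]
  rw [e1, e2, e2, ← mul_pow] at h
  exact le_of_sq_le_sq h (mul_nonneg (wnorm_nonneg _ _) (wnorm_nonneg _ _))

/-- Jensen's inequality for the rows of a stochastic matrix. -/
theorem sq_mulVec_le_of_stochastic {P : Matrix X X ℝ} (hP0 : ∀ x y, 0 ≤ P x y)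
    (hP1 : ∀ x, ∑ y, P x y = 1) (f : X → ℝ) (x : X) :
    (P.mulVec f x) ^ 2 ≤ ∑ y, P x y * f y ^ 2 := by
  have h := (even_two.convexOn_pow (𝕜 := ℝ)).map_sum_le (t := Finset.univ) (w := P x) (p := f)
    (fun y _ => hP0 x y) (hP1 x) (fun _ _ => Set.mem_univ _)
  simpa [Matrix.mulVec, dotProduct] using h

/-- A stochastic matrix with stationary distribution `ν` has operator norm at most `√δ(ν, μ)` for
the `μ`-weighted norm. -/
theorem wnorm_mulVec_le [Nonempty X] {P : Matrix X X ℝ} (hP0 : ∀ x y, 0 ≤ P x y)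
    (hP1 : ∀ x, ∑ y, P x y = 1) {μ ν : X → ℝ} (hμ : ∀ x, 0 < μ x) (hν : ∀ x, 0 < ν x)
    (hstat : ∀ y, ∑ x, ν x * P x y = ν y) {δ : ℝ}
    (hδ : ∀ x y, ν x / μ x * (μ y / ν y) ≤ δ) (f : X → ℝ) :
    wnorm μ (P.mulVec f) ≤ √δ * wnorm μ f := by
  obtain ⟨y, hy⟩ := Finite.exists_max fun x => μ x / ν x
  have hc : 0 ≤ μ y / ν y := (div_pos (hμ y) (hν y)).le
  have hδ0 : 0 ≤ δ := (mul_nonneg (div_pos (hν y) (hμ y)).le hc).trans (hδ y y)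
  rw [wnorm, wnorm, ← Real.sqrt_mul hδ0]
  refine Real.sqrt_le_sqrt ?_
  calc ∑ x, μ x * P.mulVec f x ^ 2
      ≤ ∑ x, μ y / ν y * ν x * ∑ z, P x z * f z ^ 2 := by
        refine Finset.sum_le_sum fun x _ => mul_le_mul ?_
          (sq_mulVec_le_of_stochastic hP0 hP1 f x) (sq_nonneg _) (mul_nonneg hc (hν x).le)
        exact (div_le_iff₀ (hν x)).1 (hy x)
    _ = ∑ z, μ y / ν y * ν z * f z ^ 2 := by
        simp_rw [Finset.mul_sum]
        rw [Finset.sum_comm]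
        refine Finset.sum_congr rfl fun z _ => ?_
        rw [← hstat z, Finset.mul_sum, Finset.sum_mul]
        exact Finset.sum_congr rfl fun x _ => by ring
    _ ≤ ∑ z, δ * (μ z * f z ^ 2) := by
        refine Finset.sum_le_sum fun z _ => ?_
        rw [← mul_assoc]
        refine mul_le_mul_of_nonneg_right ?_ (sq_nonneg _)
        have h := mul_le_mul_of_nonneg_right (hδ z y) (hμ z).le
        refine le_of_eq_of_le ?_ h
        have := (hμ z).ne'
        field_simp
    _ = δ * ∑ z, μ z * f z ^ 2 := (Finset.mul_sum ..).symm

variable [DecidableEq X] {ι : Type*} [Fintype ι]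

theorem dotProduct_transpose_mul_diagonal_mulVec (Φ : Matrix X ι ℝ) (μ : X → ℝ) (u : ι → ℝ)
    (z : X → ℝ) :
    u ⬝ᵥ (Φᵀ * Matrix.diagonal μ) *ᵥ z = ∑ x, μ x * ((Φ *ᵥ u) x * z x) := by
  rw [← Matrix.mulVec_mulVec, Matrix.dotProduct_mulVec, Matrix.vecMul_transpose, dotProduct]
  refine Finset.sum_congr rfl fun x _ => ?_
  rw [Matrix.mulVec_diagonal]
  ring

variable [DecidableEq ι]

theorem isUnit_det_gram {Φ : Matrix X ι ℝ} (hΦ : Function.Injective Φ.mulVec) {μ : X → ℝ}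
    (hμ : ∀ x, 0 < μ x) : IsUnit (Φᵀ * Matrix.diagonal μ * Φ).det := by
  have h : (Φᵀ * Matrix.diagonal μ * Φ).PosDef := by
    simpa using (Matrix.PosDef.diagonal hμ).conjTranspose_mul_mul_same hΦ
  exact h.det_pos.ne'.isUnit

/-- The residual of the weighted projection onto the range of `Φ` is orthogonal to that range. -/
theorem orthogonal_of_mulVec_eq_proj {Φ : Matrix X ι ℝ} (hΦ : Function.Injective Φ.mulVec)
    {μ : X → ℝ} (hμ : ∀ x, 0 < μ x) {w : ι → ℝ} {z : X → ℝ}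
    (hw : Φ *ᵥ w = (Φ * (Φᵀ * Matrix.diagonal μ * Φ)⁻¹ * Φᵀ * Matrix.diagonal μ) *ᵥ z)
    (u : ι → ℝ) : ∑ x, μ x * ((Φ *ᵥ u) x * ((Φ *ᵥ w) x - z x)) = 0 := by
  have h1 : w = ((Φᵀ * Matrix.diagonal μ * Φ)⁻¹ * (Φᵀ * Matrix.diagonal μ)) *ᵥ z := by
    apply hΦ
    rw [hw, Matrix.mulVec_mulVec]
    simp only [Matrix.mul_assoc]
  have h2 : (Φᵀ * Matrix.diagonal μ) *ᵥ (Φ *ᵥ w) = (Φᵀ * Matrix.diagonal μ) *ᵥ z := by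
    rw [Matrix.mulVec_mulVec, h1, Matrix.mulVec_mulVec,
      Matrix.mul_nonsing_inv_cancel_left _ _ (isUnit_det_gram hΦ hμ)]
  have h3 := dotProduct_transpose_mul_diagonal_mulVec Φ μ u (Φ *ᵥ w - z)
  rw [Matrix.mulVec_sub, h2, sub_self, dotProduct_zero] at h3
  exact h3.symm

end Weighted

/-- Evaluating the quadratic form of the contraction matrix at `(v, -v)`. -/
theorem weighted_inner_mulVec_le_of_posSemidef {X ι : Type*} [Fintype X] [Fintype ι]
    {P : Matrix X X ℝ} (hP1 : ∀ x, ∑ y, P x y = 1) (Φ : Matrix X ι ℝ) {μ : X → ℝ}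
    (hμ : ∀ x, 0 ≤ μ x)
    (hF : (∑ x, μ x • ∑ y, P x y •
        Matrix.fromBlocks (vecMulVec (Φ x) (Φ x)) (vecMulVec (Φ x) (Φ y))
          (vecMulVec (Φ y) (Φ x)) (vecMulVec (Φ x) (Φ x))).PosSemidef)
    (v : ι → ℝ) :
    ∑ x, μ x * ((Φ *ᵥ v) x * (P *ᵥ (Φ *ᵥ v)) x) ≤ wnorm μ (Φ *ᵥ v) ^ 2 := by
  have h := hF.dotProduct_mulVec_nonneg (Sum.elim v (-v))
  have hb (x y : X) : Sum.elim v (-v) ⬝ᵥ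
      (Matrix.fromBlocks (vecMulVec (Φ x) (Φ x)) (vecMulVec (Φ x) (Φ y))
          (vecMulVec (Φ y) (Φ x)) (vecMulVec (Φ x) (Φ x))) *ᵥ Sum.elim v (-v)
      = 2 * (Φ *ᵥ v) x ^ 2 - 2 * ((Φ *ᵥ v) x * (Φ *ᵥ v) y) := by
    have hc (x : X) : v ⬝ᵥ Φ x = (Φ *ᵥ v) x := dotProduct_comm _ _
    have hc' (x : X) : Φ x ⬝ᵥ v = (Φ *ᵥ v) x := rfl
    simp only [Matrix.fromBlocks_mulVec, Sum.elim_comp_inl, Sum.elim_comp_inr,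
      sumElim_dotProduct_sumElim, Matrix.vecMulVec_mulVec, dotProduct_add, Matrix.mulVec_neg,
      dotProduct_neg, neg_dotProduct, op_smul_eq_smul, dotProduct_smul, hc, hc', smul_eq_mul]
    ring
  simp only [star_trivial, Matrix.sum_mulVec, Matrix.smul_mulVec, dotProduct_sum,
    dotProduct_smul, hb, smul_eq_mul] at h
  have e : ∑ x, μ x * ∑ y, P x y * (2 * (Φ *ᵥ v) x ^ 2 - 2 * ((Φ *ᵥ v) x * (Φ *ᵥ v) y))
      = 2 * ∑ x, μ x * (Φ *ᵥ v) x ^ 2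
        - 2 * ∑ x, μ x * ((Φ *ᵥ v) x * (P *ᵥ (Φ *ᵥ v)) x) := by
    rw [Finset.mul_sum, Finset.mul_sum, ← Finset.sum_sub_distrib]
    refine Finset.sum_congr rfl fun x _ => ?_
    have e1 : ∑ y, P x y * (2 * (Φ *ᵥ v) x ^ 2 - 2 * ((Φ *ᵥ v) x * (Φ *ᵥ v) y))
        = 2 * (Φ *ᵥ v) x ^ 2 - 2 * ((Φ *ᵥ v) x * ∑ y, P x y * (Φ *ᵥ v) y) := by
      simp_rw [mul_sub, Finset.sum_sub_distrib, ← Finset.sum_mul, hP1, one_mul, Finset.mul_sum]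
      congr 1
      exact Finset.sum_congr rfl fun y _ => by ring
    have e2 : (P *ᵥ (Φ *ᵥ v)) x = ∑ y, P x y * (Φ *ᵥ v) y := rfl
    rw [e1, e2]
    ring
  rw [e] at h
  rw [wnorm_sq hμ]
  linarith

/-- Lemma 1, MDP version: under the MDP contraction mapping condition
`E_{(s,a)∼μ}[F^π(s,a)] ⪰ 0`, the projected TD fixed point `Φw⋆` satisfies
`‖Φw⋆ − Q^π‖_μ ≤ ((1 + γ√δ(ν,μ))/(1 − γ)) · min_w ‖Φw − Q^π‖_μ`. -/
theorem stmt6 {S A : Type*} [Fintype S] [Fintype A] [DecidableEq S] [DecidableEq A]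
    (k : ℕ)
    -- transition kernel
    (p : S → A → S → ℝ)
    (hp0 : ∀ s a s', 0 ≤ p s a s') (hp1 : ∀ s a, ∑ s', p s a s' = 1)
    -- reward, discount
    (r : S × A → ℝ) (γ : ℝ) (hγ0 : 0 < γ) (hγ1 : γ < 1)
    -- policy
    (π : S → A → ℝ) (hπ0 : ∀ s a, 0 ≤ π s a) (hπ1 : ∀ s, ∑ a, π s a = 1)
    -- features: Φ has full column rank; its row at (s,a) is φ(s,a)ᵀ
    (Φ : Matrix (S × A) (Fin k) ℝ) (hΦ : Function.Injective Φ.mulVec)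
    -- sampling distribution with full support
    (μ : S × A → ℝ) (hμ0 : ∀ x, 0 < μ x) (hμ1 : ∑ x, μ x = 1)
    (D : Matrix (S × A) (S × A) ℝ) (hD : D = Matrix.diagonal μ)
    (Proj : Matrix (S × A) (S × A) ℝ)
    (hProj : Proj = Φ * (Φᵀ * D * Φ)⁻¹ * Φᵀ * D)
    -- the induced chain on X = S × A
    (Pπ : Matrix (S × A) (S × A) ℝ)
    (hPπ : ∀ s a s' a', Pπ (s, a) (s', a') = p s a s' * π s' a')
    -- the matrices F^π(s,a)
    (F : S × A → Matrix (Fin k ⊕ Fin k) (Fin k ⊕ Fin k) ℝ)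
    (hFdef : ∀ x : S × A, F x = ∑ x' : S × A, Pπ x x' •
        Matrix.fromBlocks (vecMulVec (Φ x) (Φ x)) (vecMulVec (Φ x) (Φ x'))
          (vecMulVec (Φ x') (Φ x)) (vecMulVec (Φ x) (Φ x)))
    -- MDP contraction mapping condition: E_{(s,a)∼μ}[F^π(s,a)] ⪰ 0
    (hF : (∑ x : S × A, μ x • F x).PosSemidef)
    -- ν is a stationary distribution of Pπ with full support
    (ν : S × A → ℝ) (hν0 : ∀ x, 0 < ν x) (hν1 : ∑ x, ν x = 1)
    (hstat : ∀ x', ∑ x, ν x * Pπ x x' = ν x')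
    -- Q^π is the (unique) solution of the Bellman equation
    (Q : S × A → ℝ)
    (hQ : ∀ s a, Q (s, a) = r (s, a) +
        γ * ∑ s', p s a s' * ∑ a', π s' a' * Q (s', a'))
    -- w⋆ satisfies the projected fixed-point equation
    (w : Fin k → ℝ)
    (hw : Φ.mulVec w = Proj.mulVec (fun x => r x + γ * Pπ.mulVec (Φ.mulVec w) x))
    -- δ(ν, μ) is the maximum of (ν(s,a)/μ(s,a))·(μ(s̃,ã)/ν(s̃,ã)) over pairs
    (δ : ℝ)
    (hδ : IsGreatest {d : ℝ | ∃ x y : S × A, d = ν x / μ x * (μ y / ν y)} δ) :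
    wnorm μ (Φ.mulVec w - Q)
      ≤ ((1 + γ * Real.sqrt δ) / (1 - γ)) *
          ⨅ w' : Fin k → ℝ, wnorm μ (Φ.mulVec w' - Q) := by
  have hP0 : ∀ x y, 0 ≤ Pπ x y := fun ⟨s, a⟩ ⟨s', a'⟩ => by
    rw [hPπ]
    exact mul_nonneg (hp0 _ _ _) (hπ0 _ _)
  have hP1 : ∀ x, ∑ y, Pπ x y = 1 := fun ⟨s, a⟩ => by
    simp_rw [Fintype.sum_prod_type, hPπ, ← Finset.mul_sum, hπ1, mul_one, hp1]
  have hQ' : ∀ x, Q x = r x + γ * (Pπ *ᵥ Q) x := fun ⟨s, a⟩ => by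
    rw [hQ]
    simp_rw [Matrix.mulVec, dotProduct, Fintype.sum_prod_type, hPπ, Finset.mul_sum, mul_assoc]
  have hμ : ∀ x, 0 ≤ μ x := fun x => (hμ0 x).le
  have hne : Nonempty (S × A) := by
    by_contra hemp
    rw [not_nonempty_iff] at hemp
    simp at hμ1
  subst hD hProj
  simp_rw [hFdef] at hF
  obtain ⟨w₀, hw₀⟩ : ∃ w₀, Φ *ᵥ w₀
      = (Φ * (Φᵀ * Matrix.diagonal μ * Φ)⁻¹ * Φᵀ * Matrix.diagonal μ) *ᵥ Q :=
    ⟨((Φᵀ * Matrix.diagonal μ * Φ)⁻¹ * (Φᵀ * Matrix.diagonal μ)) *ᵥ Q, by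
      rw [Matrix.mulVec_mulVec]
      simp only [Matrix.mul_assoc]⟩
  have horth := orthogonal_of_mulVec_eq_proj hΦ hμ0 hw₀
  have hgal := orthogonal_of_mulVec_eq_proj hΦ hμ0 hw
  set d : S × A → ℝ := Φ *ᵥ w₀ - Q with hd
  set e : S × A → ℝ := Φ *ᵥ (w - w₀) with he
  have hsplit : Φ *ᵥ w - Q = e + d := by
    rw [he, hd, Matrix.mulVec_sub]
    abel
  have hbest (w' : Fin k → ℝ) : wnorm μ d ≤ wnorm μ (Φ *ᵥ w' - Q) := by
    have h : Φ *ᵥ w' - Q = Φ *ᵥ (w' - w₀) + d := by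
      rw [hd, Matrix.mulVec_sub]
      abel
    have h2 := wnorm_add_sq_of_orthogonal hμ (horth (w' - w₀))
    rw [h]
    refine le_of_sq_le_sq ?_ (wnorm_nonneg _ _)
    refine le_of_le_of_eq ?_ h2.symm
    exact le_add_of_nonneg_left (sq_nonneg _)
  have hed : wnorm μ (e + d) ^ 2 = wnorm μ e ^ 2 + wnorm μ d ^ 2 :=
    wnorm_add_sq_of_orthogonal hμ (horth (w - w₀))
  have hcontr : ∑ x, μ x * (e x * (Pπ *ᵥ e) x) ≤ wnorm μ e ^ 2 :=
    weighted_inner_mulVec_le_of_posSemidef hP1 Φ hμ hF (w - w₀)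
  have hPd : wnorm μ (Pπ *ᵥ d) ≤ √δ * wnorm μ d :=
    wnorm_mulVec_le hP0 hP1 hμ0 hν0 hstat (fun x y => hδ.2 ⟨x, y, rfl⟩) d
  have hcs := weighted_inner_le hμ e (Pπ *ᵥ d)
  have heq : wnorm μ e ^ 2 = γ * ∑ x, μ x * (e x * (Pπ *ᵥ e) x)
      + γ * ∑ x, μ x * (e x * (Pπ *ᵥ d) x) := by
    have h1 := hgal (w - w₀)
    have h2 := horth (w - w₀)
    have hPw : Pπ *ᵥ (Φ *ᵥ w) = Pπ *ᵥ Q + Pπ *ᵥ e + Pπ *ᵥ d := by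
      rw [← Matrix.mulVec_add, ← Matrix.mulVec_add, add_assoc, ← hsplit]
      congr 1
      abel
    have hx : ∀ x, μ x * (e x * ((Φ *ᵥ w) x - (r x + γ * (Pπ *ᵥ (Φ *ᵥ w)) x)))
        = μ x * e x ^ 2 + μ x * (e x * ((Φ *ᵥ w₀) x - Q x))
          - γ * (μ x * (e x * (Pπ *ᵥ e) x)) - γ * (μ x * (e x * (Pπ *ᵥ d) x)) := fun x => by
      have hs := congrFun hsplit x
      simp only [Pi.sub_apply, Pi.add_apply, hd] at hs
      rw [hPw]
      simp only [Pi.add_apply]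
      linear_combination μ x * e x * hs + μ x * e x * hQ' x
    rw [← he] at h1 h2
    simp_rw [hx, Finset.sum_sub_distrib, Finset.sum_add_distrib, ← Finset.mul_sum] at h1
    rw [h2] at h1
    rw [wnorm_sq hμ]
    linarith
  have h1γ : 0 < 1 - γ := sub_pos.2 hγ1
  have he0 := wnorm_nonneg μ e
  have hd0 := wnorm_nonneg μ d
  have hmain : (1 - γ) * wnorm μ e ≤ γ * √δ * wnorm μ d := by
    rcases he0.eq_or_lt with h0 | hpos
    · rw [← h0, mul_zero]
      positivity
    · refine le_of_mul_le_mul_left ?_ hpos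
      have h3 := mul_le_mul_of_nonneg_left hPd he0
      have h4 := mul_le_mul_of_nonneg_left (hcs.trans h3) hγ0.le
      have h5 := mul_le_mul_of_nonneg_left hcontr hγ0.le
      linarith
  have htri : wnorm μ (e + d) ≤ wnorm μ e + wnorm μ d := by
    refine le_of_sq_le_sq ?_ (add_nonneg he0 hd0)
    nlinarith [mul_nonneg he0 hd0]
  have hfinal : wnorm μ (e + d) ≤ (1 + γ * √δ) / (1 - γ) * wnorm μ d := by
    rw [div_mul_eq_mul_div, le_div_iff₀ h1γ]
    have h6 := mul_le_mul_of_nonneg_right htri h1γ.le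
    nlinarith [mul_nonneg hγ0.le hd0]
  rw [hsplit]
  refine hfinal.trans (mul_le_mul_of_nonneg_left (le_ciInf hbest) ?_)
  positivity
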